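/- arXiv:2005.02232 — 2 statements merged into one kernel-verified Lean document; each statement's English description precedes it below -/
import Mathlib

section
/- Let R > 0 and let u : ℝ^d → ℝ be a convex function with −R ≤ u(z) ≤ R(1+|z|²) for all z. Then for all x, y ∈ ℝ^d, |V_u(x) − V_u(y)| ≤ C₅(R)·(1 + |x| + |y|)·|x − y|, where C₅(R) := 1 + √(C₁(R)) and C₁(R) := 8R+2. -/
/-- The Moreau envelope of `u`: `V_u(x) = inf_y (½|x−y|² + u(y))`. -/
noncomputable def moreau {d : ℕ} (u : EuclideanSpace ℝ (Fin d) → ℝ)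
    (x : EuclideanSpace ℝ (Fin d)) : ℝ :=
  ⨅ y : EuclideanSpace ℝ (Fin d), (1 / 2) * ‖x - y‖ ^ 2 + u y

theorem moreau_le {d : ℕ} {u : EuclideanSpace ℝ (Fin d) → ℝ} {m : ℝ} (hu : ∀ z, m ≤ u z)
    (x z : EuclideanSpace ℝ (Fin d)) :
    moreau u x ≤ (1 / 2) * ‖x - z‖ ^ 2 + u z := by
  refine ciInf_le (f := fun z => (1 / 2) * ‖x - z‖ ^ 2 + u z) ⟨m, ?_⟩ z
  rintro _ ⟨w, rfl⟩
  have := hu w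
  have : 0 ≤ ‖x - w‖ ^ 2 := by positivity
  dsimp only
  linarith

/-- One-sided form of the local Lipschitz bound for the Moreau envelope. -/
theorem moreau_sub_le {d : ℕ} {R : ℝ} (hR : 0 < R) {u : EuclideanSpace ℝ (Fin d) → ℝ}
    (hbound : ∀ z, -R ≤ u z ∧ u z ≤ R * (1 + ‖z‖ ^ 2)) (x y : EuclideanSpace ℝ (Fin d)) :
    moreau u x - moreau u y ≤
      (1 + Real.sqrt (8 * R + 2)) * (1 + ‖x‖ + ‖y‖) * ‖x - y‖ := by
  have key : ∀ z, ‖y - z‖ ≤ Real.sqrt (8 * R + 2) * (1 + ‖y‖) →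
      moreau u x - (1 + Real.sqrt (8 * R + 2)) * (1 + ‖x‖ + ‖y‖) * ‖x - y‖ ≤
        (1 / 2) * ‖y - z‖ ^ 2 + u z := by
    intro z hz
    have hV := moreau_le (fun w => (hbound w).1) x z
    have htri : ‖x - z‖ ≤ ‖x - y‖ + ‖y - z‖ := norm_sub_le_norm_sub_add_norm_sub x y z
    have hsq : ‖x - z‖ ^ 2 ≤ (‖x - y‖ + ‖y - z‖) ^ 2 := by gcongr
    have hxy : ‖x - y‖ ≤ ‖x‖ + ‖y‖ := norm_sub_le x y
    have hslope : (1 / 2) * ‖x - y‖ + ‖y - z‖ ≤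
        (1 + Real.sqrt (8 * R + 2)) * (1 + ‖x‖ + ‖y‖) := by
      have : 0 ≤ Real.sqrt (8 * R + 2) * ‖x‖ := by positivity
      linarith [norm_nonneg x, norm_nonneg y]
    have := mul_le_mul_of_nonneg_right hslope (norm_nonneg (x - y))
    linarith
  have hself := key y (by rw [sub_self, norm_zero]; positivity)
  rw [sub_self, norm_zero] at hself
  rw [sub_le_comm]
  refine le_ciInf fun z => ?_
  rcases le_total ‖y - z‖ (Real.sqrt (8 * R + 2) * (1 + ‖y‖)) with hz | hz
  · exact key z hz
  · have hsq : (8 * R + 2) * (1 + ‖y‖) ^ 2 ≤ ‖y - z‖ ^ 2 := by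
      have := pow_le_pow_left₀ (by positivity) hz 2
      rwa [mul_pow, Real.sq_sqrt (by positivity)] at this
    have : 0 ≤ R * ‖y‖ := by positivity
    have : 0 ≤ R * ‖y‖ ^ 2 := by positivity
    linarith [(hbound z).1, (hbound y).2, sq_nonneg (1 + ‖y‖)]

/-- Let `R > 0` and `u : ℝ^d → ℝ` convex with `−R ≤ u(z) ≤ R(1+|z|²)`.
Then for all `x, y`,
`|V_u(x) − V_u(y)| ≤ C₅(R)·(1+|x|+|y|)·|x−y|` where `C₅(R) = 1+√(C₁(R))`
and `C₁(R) = 8R+2`. -/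
theorem moreau_locally_lipschitz {d : ℕ} (R : ℝ) (hR : 0 < R)
    (u : EuclideanSpace ℝ (Fin d) → ℝ)
    (hconv : ConvexOn ℝ Set.univ u)
    (hbound : ∀ z, -R ≤ u z ∧ u z ≤ R * (1 + ‖z‖ ^ 2)) :
    ∀ x y, |moreau u x - moreau u y| ≤
      (1 + Real.sqrt (8 * R + 2)) * (1 + ‖x‖ + ‖y‖) * ‖x - y‖ := by
  intro x y
  refine abs_sub_le_iff.mpr ⟨moreau_sub_le hR hbound x y, ?_⟩
  have h := moreau_sub_le hR hbound y x
  rwa [norm_sub_rev y x, add_right_comm] at h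
end

section
/- Let T ∈ ℕ* and C > 0. Set B₂ := (𝒫₂(ℝ^{2d}))^T × 𝒫₂(ℝ^d), equipped with d₁(b,b') defined as the sum of the componentwise Kantorovich–Rubinstein distances. For each t ∈ {0,…,T−1}, let M_t be a nonempty subset of 𝒫₂^C(ℝ^d). Let F : {0,…,T} × ℝ^d × B₂ → ℝ and P : {0,…,T−1} × B₂ → ℝ^d satisfy, for all t and all b₁, b₂ ∈ B₂: F(t,·,b₁) is convex with −C ≤ F(t,x,b₁) ≤ C(1+|x|²); ‖F(t,·,b₁) − F(t,·,b₂)‖_{𝒢,2} ≤ C·d₁(b₁,b₂); |P(t,b₁) − P(t,b₂)| ≤ C·d₁(b₁,b₂); and |P(t,b₁)| ≤ C. For b ∈ B₂, let u*(·,·,b) be the unique at-most-quadratic-growth solution of the backward recursion u*(T,x,b) = F(T,x,b), ū*(t+1,x,b) = sup_{ξ∈M_t} ∫ u*(t+1,x+y,b) dξ(y), u*(t,x,b) = inf_{a∈ℝ^d}( ½|a|² + ⟨a,P(t,b)⟩ + F(t,x,b) + ū*(t+1,x+a,b) ). Then there exists a constant C' > 0 depending only on C and T such that for all t ∈ {0,…,T}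 and all b₁, b₂ ∈ B₂: ‖u*(t,·,b₁) − u*(t,·,b₂)‖_{𝒢,2} ≤ C'·d₁(b₁,b₂), and for all t ∈ {1,…,T}: ‖ū*(t,·,b₁) − ū*(t,·,b₂)‖_{𝒢,2} ≤ C'·d₁(b₁,b₂). -/
open MeasureTheory ENNReal
open scoped RealInnerProductSpace

/-- `ℝ^d` with the Euclidean norm. -/
abbrev Euc (d : ℕ) := EuclideanSpace ℝ (Fin d)

/-- `ℝ^{2d} = ℝ^d × ℝ^d` with the Euclidean (L²) product norm. -/
abbrev Euc2 (d : ℕ) := WithLp 2 (Euc d × Euc d)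

noncomputable instance (d : ℕ) : MeasurableSpace (Euc2 d) := borel _
instance (d : ℕ) : BorelSpace (Euc2 d) := ⟨rfl⟩

/-- The Kantorovich–Rubinstein distance: the supremum of `∫ φ dμ − ∫ φ dν` over
1-Lipschitz functions `φ`. -/
noncomputable def d1 {X : Type*} [MeasurableSpace X] [NormedAddCommGroup X]
    (μ ν : Measure X) : ℝ :=
  sSup {r : ℝ | ∃ φ : X → ℝ, LipschitzWith 1 φ ∧ r = ∫ x, φ x ∂μ - ∫ x, φ x ∂ν}

/-- The set of beliefs `B₂ = (𝒫(ℝ^{2d}))^T × 𝒫(ℝ^d)` (as raw measures, possibly not of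
finite second moment: membership in `𝒫₂` is the predicate `MemB2`). -/
def B2 (T d : ℕ) := (Fin T → Measure (Euc2 d)) × Measure (Euc d)

/-- `b ∈ (𝒫₂(ℝ^{2d}))^T × 𝒫₂(ℝ^d)`: all components are Borel probability measures with
finite second moments. -/
def MemB2 {T d : ℕ} (b : B2 T d) : Prop :=
  (∀ t : Fin T, IsProbabilityMeasure (b.1 t) ∧
    ∫⁻ z, (‖z‖₊ : ℝ≥0∞) ^ (2 : ℕ) ∂(b.1 t) < ⊤) ∧
  IsProbabilityMeasure b.2 ∧ ∫⁻ x, (‖x‖₊ : ℝ≥0∞) ^ (2 : ℕ) ∂b.2 < ⊤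

/-- The distance on beliefs: the sum of the componentwise Kantorovich–Rubinstein
distances. -/
noncomputable def d1B {T d : ℕ} (b b' : B2 T d) : ℝ :=
  (∑ t : Fin T, d1 (b.1 t) (b'.1 t)) + d1 b.2 b'.2

/-- `(u, ū)` is an at-most-quadratic-growth solution of the backward dynamic
programming recursion with data `(Fb, Pb, M)`. -/
def IsDPRecursion (T : ℕ) {d : ℕ} (M : ℕ → Set (Measure (Euc d)))
    (Fb : ℕ → Euc d → ℝ) (Pb : ℕ → Euc d) (u ubar : ℕ → Euc d → ℝ) : Prop :=
  (∀ t ≤ T, ∃ K : ℝ, ∀ x, |u t x| ≤ K * (1 + ‖x‖ ^ 2)) ∧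
  (∀ t, 1 ≤ t → t ≤ T → ∃ K : ℝ, ∀ x, |ubar t x| ≤ K * (1 + ‖x‖ ^ 2)) ∧
  (∀ x, u T x = Fb T x) ∧
  (∀ t < T, ∀ x, ubar (t + 1) x =
    ⨆ ξ : M t, ∫ y, u (t + 1) (x + y) ∂(ξ : Measure (Euc d))) ∧
  (∀ t < T, ∀ x, u t x =
    ⨅ a : Euc d, (1 / 2) * ‖a‖ ^ 2 + ⟪a, Pb t⟫ + Fb t x + ubar (t + 1) (x + a))

/-- `f` is convex, bounded below by `-K` and above by `K * (1 + ‖x‖ ^ 2)`. -/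
structure ConvexQuadGrowth {E : Type*} [NormedAddCommGroup E] [NormedSpace ℝ E]
    (K : ℝ) (f : E → ℝ) : Prop where
  convexOn : ConvexOn ℝ Set.univ f
  neg_le : ∀ x, -K ≤ f x
  le : ∀ x, f x ≤ K * (1 + ‖x‖ ^ 2)

theorem ConvexQuadGrowth.abs_le_mul {E : Type*} [NormedAddCommGroup E] [NormedSpace ℝ E]
    {K : ℝ} {u : E → ℝ} (hu : ConvexQuadGrowth K u) (hK : 0 ≤ K)
    (x : E) : |u x| ≤ K * (1 + ‖x‖ ^ 2) :=
  abs_le.2 ⟨by nlinarith [hu.neg_le x, mul_nonneg hK (sq_nonneg ‖x‖)], hu.le x⟩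

theorem ConvexQuadGrowth.mono {E : Type*} [NormedAddCommGroup E] [NormedSpace ℝ E]
    {K K' : ℝ} {f : E → ℝ} (hf : ConvexQuadGrowth K f) (h : K ≤ K') : ConvexQuadGrowth K' f :=
  ⟨hf.convexOn, fun x => by linarith [hf.neg_le x],
    fun x => (hf.le x).trans (by gcongr)⟩

theorem norm_add_sq_le_two_mul {E : Type*} [SeminormedAddCommGroup E] (x y : E) :
    ‖x + y‖ ^ 2 ≤ 2 * ‖x‖ ^ 2 + 2 * ‖y‖ ^ 2 := by
  have h := norm_add_le x y
  nlinarith [norm_nonneg (x + y), sq_nonneg (‖x‖ - ‖y‖), norm_nonneg x, norm_nonneg y]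

theorem ConvexOn.continuous_of_univ {E : Type*} [NormedAddCommGroup E] [NormedSpace ℝ E]
    [FiniteDimensional ℝ E] {f : E → ℝ} (hf : ConvexOn ℝ Set.univ f) : Continuous f := by
  rw [← continuousOn_univ]
  exact hf.continuousOn isOpen_univ

/-- The infimum over the second variable of a jointly convex function bounded below is convex. -/
theorem convexOn_iInf_of_jointly {E A : Type*} [AddCommGroup E] [Module ℝ E]
    [AddCommGroup A] [Module ℝ A] {J : E → A → ℝ}
    (hJ : ∀ x y a b, ∀ s t : ℝ, 0 ≤ s → 0 ≤ t → s + t = 1 →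
      J (s • x + t • y) (s • a + t • b) ≤ s * J x a + t * J y b)
    (hbdd : ∀ x, BddBelow (Set.range (J x))) :
    ConvexOn ℝ Set.univ fun x => ⨅ a, J x a := by
  refine ⟨convex_univ, fun x _ y _ s t hs ht hst => ?_⟩
  refine le_of_forall_pos_le_add fun ε hε => ?_
  obtain ⟨a, ha⟩ := exists_lt_of_ciInf_lt (lt_add_of_pos_right (⨅ a, J x a) hε)
  obtain ⟨b, hb⟩ := exists_lt_of_ciInf_lt (lt_add_of_pos_right (⨅ b, J y b) hε)
  have h1 := ciInf_le (hbdd (s • x + t • y)) (s • a + t • b)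
  have h2 := hJ x y a b s t hs ht hst
  have h3 := mul_le_mul_of_nonneg_left ha.le hs
  have h4 := mul_le_mul_of_nonneg_left hb.le ht
  have h5 : s * ε + t * ε = ε := by rw [← add_mul, hst, one_mul]
  simp only [smul_eq_mul]
  linarith

theorem convexOn_iSup_of_bddAbove {ι E : Type*} [Nonempty ι] [AddCommGroup E] [Module ℝ E]
    {f : ι → E → ℝ} (hf : ∀ i, ConvexOn ℝ Set.univ (f i))
    (hbdd : ∀ x, BddAbove (Set.range fun i => f i x)) :
    ConvexOn ℝ Set.univ fun x => ⨆ i, f i x := by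
  refine ⟨convex_univ, fun x _ y _ s t hs ht hst => ciSup_le fun i => ?_⟩
  refine ((hf i).2 trivial trivial hs ht hst).trans ?_
  simp only [smul_eq_mul]
  gcongr
  · exact le_ciSup (hbdd x) i
  · exact le_ciSup (hbdd y) i

section Moments

variable {E : Type*} [NormedAddCommGroup E] [MeasurableSpace E] [BorelSpace E]
  {ξ : Measure E} {C : ℝ}

theorem integrable_norm_sq_of_lintegral_le
    (h : ∫⁻ y, (‖y‖₊ : ℝ≥0∞) ^ (2 : ℕ) ∂ξ ≤ ENNReal.ofReal C) :
    Integrable (fun y => ‖y‖ ^ 2) ξ := by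
  refine ⟨(continuous_norm.pow 2).aestronglyMeasurable, ?_⟩
  refine lt_of_le_of_lt ?_ (h.trans_lt ENNReal.ofReal_lt_top)
  refine lintegral_mono fun y => ?_
  simp [enorm_eq_nnnorm]

theorem integral_norm_sq_le_of_lintegral_le (hC : 0 ≤ C)
    (h : ∫⁻ y, (‖y‖₊ : ℝ≥0∞) ^ (2 : ℕ) ∂ξ ≤ ENNReal.ofReal C) :
    ∫ y, ‖y‖ ^ 2 ∂ξ ≤ C := by
  rw [integral_eq_lintegral_of_nonneg_ae (ae_of_all _ fun y => by positivity)
    (by fun_prop)]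
  refine ENNReal.toReal_le_of_le_ofReal hC (le_trans ?_ h)
  refine lintegral_mono fun y => ?_
  simp [ENNReal.ofReal_pow, ofReal_norm, enorm_eq_nnnorm]

theorem integrable_translate_of_quadGrowth [IsProbabilityMeasure ξ] {f : E → ℝ}
    (h : ∫⁻ y, (‖y‖₊ : ℝ≥0∞) ^ (2 : ℕ) ∂ξ ≤ ENNReal.ofReal C)
    (hf : Continuous f) {K : ℝ} (hK : 0 ≤ K) (hle : ∀ x, |f x| ≤ K * (1 + ‖x‖ ^ 2)) (x : E) :
    Integrable (fun y => f (x + y)) ξ := by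
  have hi : Integrable (fun y => K * (1 + 2 * ‖x‖ ^ 2 + 2 * ‖y‖ ^ 2)) ξ :=
    ((integrable_const _).add ((integrable_norm_sq_of_lintegral_le h).const_mul 2)).const_mul K
  refine hi.mono' (by exact (hf.comp (continuous_const_add x)).aestronglyMeasurable) (ae_of_all _ fun y => ?_)
  refine (hle _).trans ?_
  refine mul_le_mul_of_nonneg_left ?_ hK
  linarith [norm_add_sq_le_two_mul x y]

theorem integral_translate_le_of_quadGrowth [IsProbabilityMeasure ξ] (hC : 0 ≤ C) {f : E → ℝ}
    (h : ∫⁻ y, (‖y‖₊ : ℝ≥0∞) ^ (2 : ℕ) ∂ξ ≤ ENNReal.ofReal C)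
    {K : ℝ} (hK : 0 ≤ K) (hle : ∀ x, f x ≤ K * (1 + ‖x‖ ^ 2)) (x : E)
    (hint : Integrable (fun y => f (x + y)) ξ) :
    ∫ y, f (x + y) ∂ξ ≤ K * (2 + 2 * C) * (1 + ‖x‖ ^ 2) := by
  have hi2 : Integrable (fun y => 2 * ‖y‖ ^ 2) ξ :=
    (integrable_norm_sq_of_lintegral_le h).const_mul 2
  have hi : Integrable (fun y => K * (1 + 2 * ‖x‖ ^ 2 + 2 * ‖y‖ ^ 2)) ξ :=
    ((integrable_const _).add hi2).const_mul K
  calc ∫ y, f (x + y) ∂ξ ≤ ∫ y, K * (1 + 2 * ‖x‖ ^ 2 + 2 * ‖y‖ ^ 2) ∂ξ := by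
        refine integral_mono hint hi fun y => (hle _).trans ?_
        refine mul_le_mul_of_nonneg_left ?_ hK
        linarith [norm_add_sq_le_two_mul x y]
    _ = K * (1 + 2 * ‖x‖ ^ 2 + 2 * ∫ y, ‖y‖ ^ 2 ∂ξ) := by
        rw [integral_const_mul, integral_add (integrable_const _) hi2, integral_const_mul]
        simp
    _ ≤ K * (1 + 2 * ‖x‖ ^ 2 + 2 * C) := by
        gcongr
        exact integral_norm_sq_le_of_lintegral_le hC h
    _ ≤ K * (2 + 2 * C) * (1 + ‖x‖ ^ 2) := by
        rw [mul_assoc]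
        gcongr
        nlinarith [sq_nonneg ‖x‖, mul_nonneg hC (sq_nonneg ‖x‖)]

end Moments

section SupStep

variable {E : Type*} [NormedAddCommGroup E] [NormedSpace ℝ E] [FiniteDimensional ℝ E]
  [MeasurableSpace E] [BorelSpace E] {C K : ℝ} {M : Set (Measure E)} {u : E → ℝ}

theorem ConvexQuadGrowth.integrable_translate (hu : ConvexQuadGrowth K u) (hK : 0 ≤ K)
    {ξ : Measure E} [IsProbabilityMeasure ξ]
    (h : ∫⁻ y, (‖y‖₊ : ℝ≥0∞) ^ (2 : ℕ) ∂ξ ≤ ENNReal.ofReal C) (x : E) :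
    Integrable (fun y => u (x + y)) ξ :=
  integrable_translate_of_quadGrowth h hu.convexOn.continuous_of_univ hK (hu.abs_le_mul hK) x

theorem ConvexQuadGrowth.bddAbove_integral (hu : ConvexQuadGrowth K u) (hK : 0 ≤ K) (hC : 0 ≤ C)
    (hM : ∀ ξ ∈ M, IsProbabilityMeasure ξ ∧
      ∫⁻ y, (‖y‖₊ : ℝ≥0∞) ^ (2 : ℕ) ∂ξ ≤ ENNReal.ofReal C) (x : E) :
    BddAbove (Set.range fun ξ : M => ∫ y, u (x + y) ∂(ξ : Measure E)) := by
  refine ⟨K * (2 + 2 * C) * (1 + ‖x‖ ^ 2), ?_⟩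
  rintro _ ⟨⟨ξ, hξ⟩, rfl⟩
  obtain ⟨_, h⟩ := hM ξ hξ
  exact integral_translate_le_of_quadGrowth hC h hK hu.le x (hu.integrable_translate hK h x)

theorem ConvexQuadGrowth.iSup_integral (hu : ConvexQuadGrowth K u) (hK : 0 ≤ K) (hC : 0 ≤ C)
    (hne : M.Nonempty) (hM : ∀ ξ ∈ M, IsProbabilityMeasure ξ ∧
      ∫⁻ y, (‖y‖₊ : ℝ≥0∞) ^ (2 : ℕ) ∂ξ ≤ ENNReal.ofReal C) :
    ConvexQuadGrowth (K * (2 + 2 * C)) fun x => ⨆ ξ : M, ∫ y, u (x + y) ∂(ξ : Measure E) := by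
  have := hne.to_subtype
  refine ⟨convexOn_iSup_of_bddAbove ?_ (hu.bddAbove_integral hK hC hM), fun x => ?_, fun x => ?_⟩
  · rintro ⟨ξ, hξ⟩
    obtain ⟨_, h⟩ := hM ξ hξ
    have hi := hu.integrable_translate hK h
    refine ⟨convex_univ, fun x _ y _ s t hs ht hst => ?_⟩
    simp only [smul_eq_mul]
    rw [← integral_const_mul, ← integral_const_mul,
      ← integral_add ((hi x).const_mul s) ((hi y).const_mul t)]
    refine integral_mono (hi _) (((hi x).const_mul s).add ((hi y).const_mul t)) fun z => ?_
    have hz : s • x + t • y + z = s • (x + z) + t • (y + z) := by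
      rw [smul_add, smul_add, add_add_add_comm, ← add_smul, hst, one_smul]
    simp only [hz]
    exact hu.convexOn.2 trivial trivial hs ht hst
  · obtain ⟨ξ, hξ⟩ := hne
    obtain ⟨_, h⟩ := hM ξ hξ
    refine le_trans ?_ (le_ciSup (hu.bddAbove_integral hK hC hM x) ⟨ξ, hξ⟩)
    have h1 : -K ≤ ∫ y, u (x + y) ∂ξ := by
      have := integral_mono (integrable_const (-K)) (hu.integrable_translate hK h x)
        fun y => hu.neg_le (x + y)
      simpa using this
    nlinarith [mul_nonneg hK hC]
  · refine ciSup_le ?_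
    rintro ⟨ξ, hξ⟩
    obtain ⟨_, h⟩ := hM ξ hξ
    exact integral_translate_le_of_quadGrowth hC h hK hu.le x (hu.integrable_translate hK h x)

theorem iSup_integral_le_add {u₁ u₂ : E → ℝ} (hu₁ : ConvexQuadGrowth K u₁)
    (hu₂ : ConvexQuadGrowth K u₂) (hK : 0 ≤ K) (hC : 0 ≤ C)
    (hne : M.Nonempty) (hM : ∀ ξ ∈ M, IsProbabilityMeasure ξ ∧
      ∫⁻ y, (‖y‖₊ : ℝ≥0∞) ^ (2 : ℕ) ∂ξ ≤ ENNReal.ofReal C) {L : ℝ} (hL : 0 ≤ L)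
    (h : ∀ x, u₁ x ≤ u₂ x + L * (1 + ‖x‖ ^ 2)) (x : E) :
    ⨆ ξ : M, ∫ y, u₁ (x + y) ∂(ξ : Measure E) ≤
      (⨆ ξ : M, ∫ y, u₂ (x + y) ∂(ξ : Measure E)) + L * (2 + 2 * C) * (1 + ‖x‖ ^ 2) := by
  have := hne.to_subtype
  refine ciSup_le ?_
  rintro ⟨ξ, hξ⟩
  obtain ⟨_, hm⟩ := hM ξ hξ
  have hi₁ := hu₁.integrable_translate hK hm x
  have hi₂ := hu₂.integrable_translate hK hm x
  have h1 := integral_translate_le_of_quadGrowth (f := fun z => u₁ z - u₂ z) hC hm hL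
    (fun z => by linarith [h z]) x (hi₁.sub hi₂)
  rw [integral_sub hi₁ hi₂] at h1
  have h2 := le_ciSup (hu₂.bddAbove_integral hK hC hM x) ⟨ξ, hξ⟩
  simp only at h2 ⊢
  linarith

end SupStep

section InfStep

variable {E : Type*} [NormedAddCommGroup E] [InnerProductSpace ℝ E] {C K : ℝ} {f v : E → ℝ} {p : E}

theorem cost_lower_bound (hf : ConvexQuadGrowth C f) (hv : ConvexQuadGrowth K v) (hp : ‖p‖ ≤ C)
    (x a : E) : (1 / 4) * ‖a‖ ^ 2 - (K + C + C ^ 2) ≤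
      (1 / 2) * ‖a‖ ^ 2 + ⟪a, p⟫ + f x + v (x + a) := by
  have h1 := abs_le.1 (abs_real_inner_le_norm a p)
  have h2 := mul_le_mul_of_nonneg_left hp (norm_nonneg a)
  nlinarith [hf.neg_le x, hv.neg_le (x + a), sq_nonneg (‖a‖ / 2 - C)]

theorem bddBelow_cost (hf : ConvexQuadGrowth C f) (hv : ConvexQuadGrowth K v) (hp : ‖p‖ ≤ C)
    (x : E) : BddBelow (Set.range fun a => (1 / 2) * ‖a‖ ^ 2 + ⟪a, p⟫ + f x + v (x + a)) := by
  refine ⟨-(K + C + C ^ 2), ?_⟩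
  rintro _ ⟨a, rfl⟩
  have := cost_lower_bound hf hv hp x a
  simp only
  linarith [sq_nonneg ‖a‖]

theorem ConvexQuadGrowth.iInf_cost (hf : ConvexQuadGrowth C f) (hv : ConvexQuadGrowth K v)
    (hp : ‖p‖ ≤ C) : ConvexQuadGrowth (K + C + C ^ 2)
      fun x => ⨅ a, (1 / 2) * ‖a‖ ^ 2 + ⟪a, p⟫ + f x + v (x + a) := by
  refine ⟨convexOn_iInf_of_jointly ?_ (bddBelow_cost hf hv hp), fun x => ?_, fun x => ?_⟩
  · intro x y a b s t hs ht hst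
    have h1 := hf.convexOn.2 (Set.mem_univ x) (Set.mem_univ y) hs ht hst
    have h2 := hv.convexOn.2 (Set.mem_univ (x + a)) (Set.mem_univ (y + b)) hs ht hst
    have h3 : ‖s • a + t • b‖ ^ 2 ≤ s * ‖a‖ ^ 2 + t * ‖b‖ ^ 2 := by
      have := (convexOn_univ_norm (E := E)).pow (fun _ _ => norm_nonneg _) 2
      exact this.2 (Set.mem_univ a) (Set.mem_univ b) hs ht hst
    have h4 : s • x + t • y + (s • a + t • b) = s • (x + a) + t • (y + b) := by
      rw [smul_add, smul_add, add_add_add_comm]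
    rw [h4, inner_add_left, real_inner_smul_left, real_inner_smul_left]
    simp only [smul_eq_mul] at h1 h2
    linarith
  · refine le_ciInf fun a => ?_
    linarith [cost_lower_bound hf hv hp x a, sq_nonneg ‖a‖]
  · refine (ciInf_le (bddBelow_cost hf hv hp x) 0).trans ?_
    have h1 := hf.le x
    have h2 := hv.le x
    simp only [norm_zero, inner_zero_left, add_zero]
    nlinarith [mul_nonneg (sq_nonneg C) (sq_nonneg ‖x‖), sq_nonneg C]

/-- Near-minimizers of the cost grow at most linearly, so the infimum of the cost depends
in a Lipschitz way on the data, in the quadratically weighted norm. -/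
theorem iInf_cost_le_add {f₁ f₂ v₁ v₂ : E → ℝ} {p₁ p₂ : E} (hC : 0 ≤ C) (hK : 0 ≤ K)
    (hf₁ : ConvexQuadGrowth C f₁) (hf₂ : ConvexQuadGrowth C f₂)
    (hv₁ : ConvexQuadGrowth K v₁) (hv₂ : ConvexQuadGrowth K v₂)
    (hp₁ : ‖p₁‖ ≤ C) (hp₂ : ‖p₂‖ ≤ C) {D L A : ℝ} (hD : 0 ≤ D) (hL : 0 ≤ L)
    (hA : A = 4 * (2 * (K + C + C ^ 2) + 1))
    (hf : ∀ x, f₁ x ≤ f₂ x + C * D * (1 + ‖x‖ ^ 2))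
    (hv : ∀ x, v₁ x ≤ v₂ x + L * D * (1 + ‖x‖ ^ 2))
    (hp : ‖p₁ - p₂‖ ≤ C * D) (x : E) :
    ⨅ a, (1 / 2) * ‖a‖ ^ 2 + ⟪a, p₁⟫ + f₁ x + v₁ (x + a) ≤
      (⨅ a, (1 / 2) * ‖a‖ ^ 2 + ⟪a, p₂⟫ + f₂ x + v₂ (x + a)) +
        ((1 + A) * C + C + L * (2 + 2 * A)) * D * (1 + ‖x‖ ^ 2) := by
  refine le_of_forall_pos_le_add fun ε hε => ?_
  obtain ⟨a, ha⟩ := exists_lt_of_ciInf_lt (lt_add_of_pos_right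
    (⨅ a, (1 / 2) * ‖a‖ ^ 2 + ⟪a, p₂⟫ + f₂ x + v₂ (x + a)) (lt_min hε one_pos))
  have hup := (hf₂.iInf_cost hv₂ hp₂).le x
  have hlow := cost_lower_bound hf₂ hv₂ hp₂ x a
  have hA0 : 0 ≤ A := by rw [hA]; positivity
  have haq : ‖a‖ ^ 2 ≤ A * (1 + ‖x‖ ^ 2) := by
    have hB : 0 ≤ K + C + C ^ 2 := by positivity
    rw [hA]
    nlinarith [min_le_right ε 1, mul_nonneg hB (sq_nonneg ‖x‖), sq_nonneg ‖x‖]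
  have hq1 : ‖a‖ ≤ (1 + A) * (1 + ‖x‖ ^ 2) := by
    nlinarith [sq_nonneg (‖a‖ - 1), sq_nonneg ‖x‖, norm_nonneg a]
  have hin : ⟪a, p₁⟫ - ⟪a, p₂⟫ ≤ (1 + A) * (1 + ‖x‖ ^ 2) * (C * D) := by
    rw [← inner_sub_right]
    refine (real_inner_le_norm _ _).trans ?_
    gcongr
  have hq2 : 1 + ‖x + a‖ ^ 2 ≤ (2 + 2 * A) * (1 + ‖x‖ ^ 2) := by
    nlinarith [norm_add_sq_le_two_mul x a]
  have hva := mul_le_mul_of_nonneg_left hq2 (mul_nonneg hL hD)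
  refine (ciInf_le (bddBelow_cost hf₁ hv₁ hp₁ x) a).trans ?_
  nlinarith [hf x, hv (x + a), min_le_left ε 1]

end InfStep

/-- The standing assumptions on the data of the recursion for a single belief. -/
structure AdmissibleData (C : ℝ) (T : ℕ) {d : ℕ} (M : ℕ → Set (Measure (Euc d)))
    (f : ℕ → Euc d → ℝ) (p : ℕ → Euc d) : Prop where
  nonempty : ∀ t < T, (M t).Nonempty
  moment : ∀ t < T, ∀ ξ ∈ M t, IsProbabilityMeasure ξ ∧
    ∫⁻ y, (‖y‖₊ : ℝ≥0∞) ^ (2 : ℕ) ∂ξ ≤ ENNReal.ofReal C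
  growth : ∀ t ≤ T, ConvexQuadGrowth C (f t)
  price : ∀ t < T, ‖p t‖ ≤ C

namespace IsDPRecursion

variable {T d : ℕ} {M : ℕ → Set (Measure (Euc d))} {f : ℕ → Euc d → ℝ} {p : ℕ → Euc d}
  {u ubar : ℕ → Euc d → ℝ} {C K : ℝ}

theorem terminal (h : IsDPRecursion T M f p u ubar) : u T = f T :=
  funext h.2.2.1

theorem ubar_eq (h : IsDPRecursion T M f p u ubar) {t : ℕ} (ht : t < T) :
    ubar (t + 1) = fun x => ⨆ ξ : M t, ∫ y, u (t + 1) (x + y) ∂(ξ : Measure (Euc d)) :=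
  funext (h.2.2.2.1 t ht)

theorem u_eq (h : IsDPRecursion T M f p u ubar) {t : ℕ} (ht : t < T) :
    u t = fun x => ⨅ a, (1 / 2) * ‖a‖ ^ 2 + ⟪a, p t⟫ + f t x + ubar (t + 1) (x + a) :=
  funext (h.2.2.2.2 t ht)

theorem growth_ubar (h : IsDPRecursion T M f p u ubar) (hd : AdmissibleData C T M f p)
    (hC : 0 ≤ C) (hK : 0 ≤ K) {t : ℕ} (ht : t < T) (hu : ConvexQuadGrowth K (u (t + 1))) :
    ConvexQuadGrowth (K * (2 + 2 * C)) (ubar (t + 1)) := by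
  rw [h.ubar_eq ht]
  exact hu.iSup_integral hK hC (hd.nonempty t ht) (hd.moment t ht)

theorem growth_u (h : IsDPRecursion T M f p u ubar) (hd : AdmissibleData C T M f p)
    {t : ℕ} (ht : t < T) (hu : ConvexQuadGrowth K (ubar (t + 1))) :
    ConvexQuadGrowth (K + C + C ^ 2) (u t) := by
  rw [h.u_eq ht]
  exact (hd.growth t ht.le).iInf_cost hu (hd.price t ht)

end IsDPRecursion

theorem exists_growth_constant {C : ℝ} (hC : 0 ≤ C) (n : ℕ) :
    ∃ K : ℝ, 0 ≤ K ∧ ∀ (T d : ℕ) (M : ℕ → Set (Measure (Euc d))) (f : ℕ → Euc d → ℝ)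
      (p : ℕ → Euc d) (u ubar : ℕ → Euc d → ℝ), AdmissibleData C T M f p →
      IsDPRecursion T M f p u ubar → ∀ t ≤ T, T ≤ t + n → ConvexQuadGrowth K (u t) := by
  induction n with
  | zero =>
    refine ⟨C, hC, fun T d M f p u ubar hd h t ht htn => ?_⟩
    obtain rfl : t = T := le_antisymm ht htn
    rw [h.terminal]
    exact hd.growth t le_rfl
  | succ n ih =>
    obtain ⟨K, hK, ih⟩ := ih
    have hKC := mul_nonneg hK hC
    refine ⟨K * (2 + 2 * C) + C + C ^ 2, by positivity, fun T d M f p u ubar hd h t ht htn => ?_⟩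
    rcases ht.eq_or_lt with rfl | ht'
    · refine (ih t d M f p u ubar hd h t le_rfl (by omega)).mono ?_
      nlinarith [sq_nonneg C]
    · exact h.growth_u hd ht' (h.growth_ubar hd hC hK ht'
        (ih T d M f p u ubar hd h (t + 1) ht' (by omega)))

theorem IsDPRecursion.ubar_sub_le {T d : ℕ} {M : ℕ → Set (Measure (Euc d))}
    {f₁ f₂ : ℕ → Euc d → ℝ} {p₁ p₂ : ℕ → Euc d} {u₁ ubar₁ u₂ ubar₂ : ℕ → Euc d → ℝ} {C K L D : ℝ}
    (h₁ : IsDPRecursion T M f₁ p₁ u₁ ubar₁) (h₂ : IsDPRecursion T M f₂ p₂ u₂ ubar₂)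
    (hd : AdmissibleData C T M f₁ p₁) (hC : 0 ≤ C) (hK : 0 ≤ K) (hL : 0 ≤ L) (hD : 0 ≤ D)
    {t : ℕ} (ht : t < T) (hu₁ : ConvexQuadGrowth K (u₁ (t + 1)))
    (hu₂ : ConvexQuadGrowth K (u₂ (t + 1)))
    (h : ∀ x, u₁ (t + 1) x ≤ u₂ (t + 1) x + L * D * (1 + ‖x‖ ^ 2)) (x : Euc d) :
    ubar₁ (t + 1) x ≤ ubar₂ (t + 1) x + L * (2 + 2 * C) * D * (1 + ‖x‖ ^ 2) := by
  rw [h₁.ubar_eq ht, h₂.ubar_eq ht]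
  have := iSup_integral_le_add hu₁ hu₂ hK hC (hd.nonempty t ht) (hd.moment t ht)
    (mul_nonneg hL hD) h x
  rwa [mul_right_comm L D] at this

theorem exists_stability_constant {C : ℝ} (hC : 0 ≤ C) (n : ℕ) :
    ∃ L : ℝ, 0 ≤ L ∧ ∀ (T d : ℕ) (M : ℕ → Set (Measure (Euc d))) (f₁ f₂ : ℕ → Euc d → ℝ)
      (p₁ p₂ : ℕ → Euc d) (u₁ ubar₁ u₂ ubar₂ : ℕ → Euc d → ℝ) (D : ℝ), 0 ≤ D →
      AdmissibleData C T M f₁ p₁ → AdmissibleData C T M f₂ p₂ →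
      (∀ t ≤ T, ∀ x, f₁ t x ≤ f₂ t x + C * D * (1 + ‖x‖ ^ 2)) →
      (∀ t < T, ‖p₁ t - p₂ t‖ ≤ C * D) →
      IsDPRecursion T M f₁ p₁ u₁ ubar₁ → IsDPRecursion T M f₂ p₂ u₂ ubar₂ →
      ∀ t ≤ T, T ≤ t + n → (∀ x, u₁ t x ≤ u₂ t x + L * D * (1 + ‖x‖ ^ 2)) ∧
        (1 ≤ t → ∀ x, ubar₁ t x ≤ ubar₂ t x + L * (2 + 2 * C) * D * (1 + ‖x‖ ^ 2)) := by
  obtain ⟨K, hK, hgrowth⟩ := exists_growth_constant hC n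
  suffices H : ∀ m ≤ n, ∃ L : ℝ, 0 ≤ L ∧ ∀ (T d : ℕ) (M : ℕ → Set (Measure (Euc d)))
      (f₁ f₂ : ℕ → Euc d → ℝ) (p₁ p₂ : ℕ → Euc d) (u₁ ubar₁ u₂ ubar₂ : ℕ → Euc d → ℝ) (D : ℝ),
      0 ≤ D → AdmissibleData C T M f₁ p₁ → AdmissibleData C T M f₂ p₂ →
      (∀ t ≤ T, ∀ x, f₁ t x ≤ f₂ t x + C * D * (1 + ‖x‖ ^ 2)) →
      (∀ t < T, ‖p₁ t - p₂ t‖ ≤ C * D) →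
      IsDPRecursion T M f₁ p₁ u₁ ubar₁ → IsDPRecursion T M f₂ p₂ u₂ ubar₂ →
      ∀ t ≤ T, T ≤ t + m → ∀ x, u₁ t x ≤ u₂ t x + L * D * (1 + ‖x‖ ^ 2) by
    obtain ⟨L, hL, H⟩ := H n le_rfl
    refine ⟨L, hL, fun T d M f₁ f₂ p₁ p₂ u₁ ubar₁ u₂ ubar₂ D hD hd₁ hd₂ hf hp h₁ h₂ t ht htn => ?_⟩
    have hu := H T d M f₁ f₂ p₁ p₂ u₁ ubar₁ u₂ ubar₂ D hD hd₁ hd₂ hf hp h₁ h₂ t ht htn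
    refine ⟨hu, fun ht1 => ?_⟩
    obtain ⟨s, rfl⟩ := Nat.exists_eq_add_of_le' ht1
    exact h₁.ubar_sub_le h₂ hd₁ hC hK hL hD ht (hgrowth _ _ _ _ _ _ _ hd₁ h₁ _ ht htn)
      (hgrowth _ _ _ _ _ _ _ hd₂ h₂ _ ht htn) hu
  intro m
  induction m with
  | zero =>
    refine fun _ => ⟨C, hC, fun T d M f₁ f₂ p₁ p₂ u₁ ubar₁ u₂ ubar₂ D hD hd₁ hd₂ hf hp h₁ h₂
      t ht htn => ?_⟩
    obtain rfl : t = T := le_antisymm ht htn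
    rw [h₁.terminal, h₂.terminal]
    exact hf t le_rfl
  | succ m ih =>
    intro hm
    obtain ⟨L, hL, ih⟩ := ih (by omega)
    obtain ⟨A, hA⟩ : ∃ A, A = 4 * (2 * (K * (2 + 2 * C) + C + C ^ 2) + 1) := ⟨_, rfl⟩
    have hKC : 0 ≤ K * (2 + 2 * C) := by positivity
    have hLC : 0 ≤ L * (2 + 2 * C) := by positivity
    have hA0 : 0 ≤ A := by rw [hA]; positivity
    refine ⟨(1 + A) * C + C + L * (2 + 2 * C) * (2 + 2 * A), by positivity,
      fun T d M f₁ f₂ p₁ p₂ u₁ ubar₁ u₂ ubar₂ D hD hd₁ hd₂ hf hp h₁ h₂ t ht htn x => ?_⟩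
    rcases ht.eq_or_lt with rfl | ht'
    · rw [h₁.terminal, h₂.terminal]
      refine (hf t le_rfl x).trans ?_
      gcongr
      nlinarith [mul_nonneg hA0 hC, mul_nonneg hLC hA0]
    · have hg₁ := hgrowth _ _ _ _ _ _ _ hd₁ h₁ (t + 1) ht' (by omega)
      have hg₂ := hgrowth _ _ _ _ _ _ _ hd₂ h₂ (t + 1) ht' (by omega)
      have hu := ih T d M f₁ f₂ p₁ p₂ u₁ ubar₁ u₂ ubar₂ D hD hd₁ hd₂ hf hp h₁ h₂ (t + 1) ht'
        (by omega)
      rw [h₁.u_eq ht', h₂.u_eq ht']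
      exact iInf_cost_le_add hC hKC (hd₁.growth t ht) (hd₂.growth t ht)
        (h₁.growth_ubar hd₁ hC hK ht' hg₁) (h₂.growth_ubar hd₂ hC hK ht' hg₂)
        (hd₁.price t ht') (hd₂.price t ht') hD hLC hA (hf t ht)
        (h₁.ubar_sub_le h₂ hd₁ hC hK hL hD ht' hg₁ hg₂ hu) (hp t ht') x

/-- Stability of the value functions with respect to the belief: under
the standing assumptions, there is `C' > 0` depending only on `C` and `T` such that for
any beliefs `b₁, b₂` and corresponding solutions of the dynamic programming recursion,
`‖u*(t,·,b₁) − u*(t,·,b₂)‖_{𝒢,2} ≤ C′·d₁(b₁,b₂)` and similarly for `ū*`. -/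
theorem value_function_stability (T : ℕ) (C : ℝ) (hT : 0 < T) (hC : 0 < C) :
    ∃ C' : ℝ, 0 < C' ∧
      ∀ (d : ℕ) (M : ℕ → Set (Measure (Euc d)))
        (F : ℕ → Euc d → B2 T d → ℝ) (P : ℕ → B2 T d → Euc d),
        (∀ t < T, (M t).Nonempty) →
        (∀ t < T, ∀ ξ ∈ M t, IsProbabilityMeasure ξ ∧
          ∫⁻ y, (‖y‖₊ : ℝ≥0∞) ^ (2 : ℕ) ∂ξ ≤ ENNReal.ofReal C) →
        (∀ t ≤ T, ∀ b : B2 T d, MemB2 b → ConvexOn ℝ Set.univ (fun x => F t x b) ∧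
          ∀ x, -C ≤ F t x b ∧ F t x b ≤ C * (1 + ‖x‖ ^ 2)) →
        (∀ t ≤ T, ∀ b₁ b₂ : B2 T d, MemB2 b₁ → MemB2 b₂ →
          ∀ x, |F t x b₁ - F t x b₂| ≤ C * d1B b₁ b₂ * (1 + ‖x‖ ^ 2)) →
        (∀ t < T, ∀ b₁ b₂ : B2 T d, MemB2 b₁ → MemB2 b₂ →
          ‖P t b₁ - P t b₂‖ ≤ C * d1B b₁ b₂) →
        (∀ t < T, ∀ b : B2 T d, MemB2 b → ‖P t b‖ ≤ C) →
        ∀ b₁ b₂ : B2 T d, MemB2 b₁ → MemB2 b₂ →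
        ∀ u₁ ubar₁ u₂ ubar₂ : ℕ → Euc d → ℝ,
          IsDPRecursion T M (fun t x => F t x b₁) (fun t => P t b₁) u₁ ubar₁ →
          IsDPRecursion T M (fun t x => F t x b₂) (fun t => P t b₂) u₂ ubar₂ →
          (∀ t ≤ T, ∀ x, |u₁ t x - u₂ t x| ≤ C' * d1B b₁ b₂ * (1 + ‖x‖ ^ 2)) ∧
          (∀ t, 1 ≤ t → t ≤ T →
            ∀ x, |ubar₁ t x - ubar₂ t x| ≤ C' * d1B b₁ b₂ * (1 + ‖x‖ ^ 2)) := by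
  obtain ⟨L, hL, H⟩ := exists_stability_constant hC.le T
  refine ⟨L * (2 + 2 * C) + 1, by positivity, ?_⟩
  intro d M F P hne hM hF hFd hPd hP b₁ b₂ hb₁ hb₂ u₁ ubar₁ u₂ ubar₂ h₁ h₂
  have hadm : ∀ b, MemB2 b → AdmissibleData C T M (fun t x => F t x b) (fun t => P t b) :=
    fun b hb => ⟨hne, hM, fun t ht => ⟨(hF t ht b hb).1, fun x => ((hF t ht b hb).2 x).1,
      fun x => ((hF t ht b hb).2 x).2⟩, fun t ht => hP t ht b hb⟩
  have hD : 0 ≤ d1B b₁ b₂ := by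
    have h0 := (abs_nonneg _).trans (hFd 0 hT.le b₁ b₂ hb₁ hb₂ 0)
    simp only [norm_zero] at h0
    exact nonneg_of_mul_nonneg_right (by linarith) hC
  have hfd : ∀ t ≤ T, ∀ x, _ := fun t ht x => abs_sub_le_iff.1 (hFd t ht b₁ b₂ hb₁ hb₂ x)
  have hle := H T d M _ _ _ _ u₁ ubar₁ u₂ ubar₂ _ hD (hadm b₁ hb₁) (hadm b₂ hb₂)
    (fun t ht x => by linarith [(hfd t ht x).1]) (fun t ht => hPd t ht b₁ b₂ hb₁ hb₂) h₁ h₂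
  have hge := H T d M _ _ _ _ u₂ ubar₂ u₁ ubar₁ _ hD (hadm b₂ hb₂) (hadm b₁ hb₁)
    (fun t ht x => by linarith [(hfd t ht x).2])
    (fun t ht => by rw [norm_sub_rev]; exact hPd t ht b₁ b₂ hb₁ hb₂) h₂ h₁
  refine ⟨fun t ht x => ?_, fun t ht1 ht x => ?_⟩
  · have hc : L * d1B b₁ b₂ * (1 + ‖x‖ ^ 2) ≤
        (L * (2 + 2 * C) + 1) * d1B b₁ b₂ * (1 + ‖x‖ ^ 2) := by
      gcongr
      nlinarith [mul_nonneg hL hC.le]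
    have h1 := (hle t ht (by omega)).1 x
    have h2 := (hge t ht (by omega)).1 x
    exact abs_sub_le_iff.2 ⟨by linarith, by linarith⟩
  · have hc : L * (2 + 2 * C) * d1B b₁ b₂ * (1 + ‖x‖ ^ 2) ≤
        (L * (2 + 2 * C) + 1) * d1B b₁ b₂ * (1 + ‖x‖ ^ 2) := by
      gcongr
      linarith
    have h1 := (hle t ht (by omega)).2 ht1 x
    have h2 := (hge t ht (by omega)).2 ht1 x
    exact abs_sub_le_iff.2 ⟨by linarith, by linarith⟩
end
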